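/- Measure-and-reprogram, single input (Lemma 1 of the paper, in a concrete register layout): Let q ≥ 1. Fix H : 𝒳 → 𝒴, x ∈ 𝒳, Θ ∈ 𝒴, a vector φ₀ ∈ V, linear maps A₁,…,A_q on V each of which is a unitary possibly composed with an orthogonal projection, and an orthogonal projection π on EuclideanSpace ℂ Z. Then (1/(2q+1)) · Σ_{(i,b) ∈ R_q} ‖G_x (A^{H*Θx}_{i+b→q} (A^H_{i→i+b} (X_x (A^H_{0→i} φ₀))))‖² ≥ ‖G_x φ_q^{H*Θx}‖² / (2q+1)². -/

import Mathlib

/- Setting: `V = EuclideanSpace ℂ (Bool × 𝒳 × 𝒴 × Z)`, the oracle operator `O_H`,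
the query projection `X_x`, reprogramming `Function.update H x Θ`, the partial runs
`A^K_{i→j}`, the lift of a projection on `EuclideanSpace ℂ Z` to `V`,
and the index set `R_q = ({0,…,q−1} × {0,1}) ∪ {(q,0)}`. -/

variable {𝒳 𝒴 Z : Type*} [Fintype 𝒳] [DecidableEq 𝒳] [Nonempty 𝒳]
  [Fintype 𝒴] [AddCommGroup 𝒴] [Fintype Z] [Nonempty Z]

/-- The oracle operator `O_H`, determined on the standard basis by
`O_H e_{(c,ξ,y,z)} = e_{(c,ξ,y + (if c then H ξ else 0), z)}`. -/
noncomputable def oracleOp (H : 𝒳 → 𝒴) :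
    EuclideanSpace ℂ (Bool × 𝒳 × 𝒴 × Z) →ₗ[ℂ] EuclideanSpace ℂ (Bool × 𝒳 × 𝒴 × Z) where
  toFun v := WithLp.toLp 2 fun p => v (p.1, p.2.1, p.2.2.1 - (if p.1 then H p.2.1 else 0), p.2.2.2)
  map_add' _ _ := rfl
  map_smul' _ _ := rfl

/-- The orthogonal projection `X_x` onto queries at `x`. -/
noncomputable def Xproj (x : 𝒳) :
    EuclideanSpace ℂ (Bool × 𝒳 × 𝒴 × Z) →ₗ[ℂ] EuclideanSpace ℂ (Bool × 𝒳 × 𝒴 × Z) where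
  toFun v := WithLp.toLp 2 fun p => if p.2.1 = x then v p else 0
  map_add' u v := PiLp.ext fun p => by by_cases h : p.2.1 = x <;> simp [h]
  map_smul' c v := PiLp.ext fun p => by by_cases h : p.2.1 = x <;> simp [h]

/-- The lift to `V` of an operator `π` on `EuclideanSpace ℂ Z`, acting as the identity on
the `Bool`, `𝒳`, `𝒴` coordinates. -/
noncomputable def liftZ (π : EuclideanSpace ℂ Z →ₗ[ℂ] EuclideanSpace ℂ Z) :
    EuclideanSpace ℂ (Bool × 𝒳 × 𝒴 × Z) →ₗ[ℂ] EuclideanSpace ℂ (Bool × 𝒳 × 𝒴 × Z) where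
  toFun v := WithLp.toLp 2 fun p => π (WithLp.toLp 2 fun z => v (p.1, p.2.1, p.2.2.1, z)) p.2.2.2
  map_add' u v := PiLp.ext fun p => by
    have h : (WithLp.toLp 2 fun z => (u + v) (p.1, p.2.1, p.2.2.1, z))
        = ((WithLp.toLp 2 fun z => u (p.1, p.2.1, p.2.2.1, z)) : EuclideanSpace ℂ Z)
          + ((WithLp.toLp 2 fun z => v (p.1, p.2.1, p.2.2.1, z)) : EuclideanSpace ℂ Z) := rfl
    show π (WithLp.toLp 2 fun z => (u + v) (p.1, p.2.1, p.2.2.1, z)) p.2.2.2 = _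
    rw [h, map_add]
    rfl
  map_smul' c v := PiLp.ext fun p => by
    have h : (WithLp.toLp 2 fun z => (c • v) (p.1, p.2.1, p.2.2.1, z))
        = c • ((WithLp.toLp 2 fun z => v (p.1, p.2.1, p.2.2.1, z)) : EuclideanSpace ℂ Z) := rfl
    show π (WithLp.toLp 2 fun z => (c • v) (p.1, p.2.1, p.2.2.1, z)) p.2.2.2 = _
    rw [h, map_smul]
    rfl

/-- `AComp A K i j = A^K_{i→j} = A_j ∘ O_K ∘ ⋯ ∘ A_{i+1} ∘ O_K` (the identity if `j ≤ i`). -/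
noncomputable def AComp
    (A : ℕ → (EuclideanSpace ℂ (Bool × 𝒳 × 𝒴 × Z) →ₗ[ℂ] EuclideanSpace ℂ (Bool × 𝒳 × 𝒴 × Z)))
    (K : 𝒳 → 𝒴) (i : ℕ) :
    ℕ → (EuclideanSpace ℂ (Bool × 𝒳 × 𝒴 × Z) →ₗ[ℂ] EuclideanSpace ℂ (Bool × 𝒳 × 𝒴 × Z))
  | 0 => LinearMap.id
  | j + 1 => if i ≤ j then A (j + 1) ∘ₗ oracleOp K ∘ₗ AComp A K i j else LinearMap.id

/-- An orthogonal projection: idempotent and self-adjoint. -/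
def IsOrthProjection {E : Type*} [NormedAddCommGroup E] [InnerProductSpace ℂ E]
    (P : E →ₗ[ℂ] E) : Prop :=
  P ∘ₗ P = P ∧ ∀ u v : E, (inner ℂ (P u) v : ℂ) = inner ℂ u (P v)

/-- A unitary map: bijective and norm-preserving. -/
def IsUnitaryOp {E : Type*} [NormedAddCommGroup E] [InnerProductSpace ℂ E]
    (U : E →ₗ[ℂ] E) : Prop :=
  Function.Bijective U ∧ ∀ v : E, ‖U v‖ = ‖v‖

/-- `R_q = ({0,…,q−1} × {0,1}) ∪ {(q,0)}`, a set of `2q+1` pairs `(i,b)`. -/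
def Rq (q : ℕ) : Finset (ℕ × ℕ) := (Finset.range q ×ˢ {0, 1}) ∪ {(q, 0)}

theorem mr_AComp_self
    (A : ℕ → (EuclideanSpace ℂ (Bool × 𝒳 × 𝒴 × Z) →ₗ[ℂ] EuclideanSpace ℂ (Bool × 𝒳 × 𝒴 × Z)))
    (K : 𝒳 → 𝒴) (i : ℕ) : AComp A K i i = LinearMap.id := by
  cases i <;> simp [AComp]

theorem mr_AComp_succ
    (A : ℕ → (EuclideanSpace ℂ (Bool × 𝒳 × 𝒴 × Z) →ₗ[ℂ] EuclideanSpace ℂ (Bool × 𝒳 × 𝒴 × Z)))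
    (K : 𝒳 → 𝒴) (i j : ℕ) (h : i ≤ j) (v : EuclideanSpace ℂ (Bool × 𝒳 × 𝒴 × Z)) :
    AComp A K i (j + 1) v = A (j + 1) (oracleOp K (AComp A K i j v)) := by
  simp [AComp, h]

theorem mr_AComp_left
    (A : ℕ → (EuclideanSpace ℂ (Bool × 𝒳 × 𝒴 × Z) →ₗ[ℂ] EuclideanSpace ℂ (Bool × 𝒳 × 𝒴 × Z)))
    (K : 𝒳 → 𝒴) (i j : ℕ) (h : i + 1 ≤ j) (v : EuclideanSpace ℂ (Bool × 𝒳 × 𝒴 × Z)) :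
    AComp A K i j v = AComp A K (i + 1) j (A (i + 1) (oracleOp K v)) := by
  induction j, h using Nat.le_induction with
  | base => rw [mr_AComp_succ A K i i le_rfl, mr_AComp_self, mr_AComp_self]; rfl
  | succ j hj ih =>
    rw [mr_AComp_succ A K i j (by omega), mr_AComp_succ A K (i + 1) j hj, ih]

theorem mr_oracle (H : 𝒳 → 𝒴) (x : 𝒳) (Θ : 𝒴) (v : EuclideanSpace ℂ (Bool × 𝒳 × 𝒴 × Z)) :
    oracleOp (Function.update H x Θ) v
      = oracleOp H v - oracleOp H (Xproj x v)
        + oracleOp (Function.update H x Θ) (Xproj x v) := by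
  refine PiLp.ext fun p => ?_
  have ho : ∀ (K : 𝒳 → 𝒴) (w : EuclideanSpace ℂ (Bool × 𝒳 × 𝒴 × Z)), (oracleOp K w) p
      = w (p.1, p.2.1, p.2.2.1 - (if p.1 then K p.2.1 else 0), p.2.2.2) := fun _ _ => rfl
  have hx : ∀ r : Bool × 𝒳 × 𝒴 × Z, (Xproj x v) r = if r.2.1 = x then v r else 0 :=
    fun _ => rfl
  rw [PiLp.add_apply, PiLp.sub_apply, ho, ho, ho, ho, hx, hx]
  by_cases h : p.2.1 = x <;> simp [h]

theorem mr_G (x : 𝒳) (π : EuclideanSpace ℂ Z →ₗ[ℂ] EuclideanSpace ℂ Z)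
    (v : EuclideanSpace ℂ (Bool × 𝒳 × 𝒴 × Z)) :
    (Xproj x ∘ₗ liftZ π) (Xproj x v) = (Xproj x ∘ₗ liftZ π) v := by
  refine PiLp.ext fun p => ?_
  by_cases h : p.2.1 = x <;> simp [liftZ, Xproj, h]

theorem mr_sum_Rq (q : ℕ) (f : ℕ × ℕ → ℝ) :
    ∑ r ∈ Rq q, f r = ∑ i ∈ Finset.range q, (f (i, 0) + f (i, 1)) + f (q, 0) := by
  unfold Rq
  rw [Finset.sum_union (by simp), Finset.sum_product]
  simp

theorem mr_card_Rq (q : ℕ) : ((Rq q).card : ℝ) = 2 * (q : ℝ) + 1 := by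
  have h := mr_sum_Rq q (fun _ => 1)
  simp only [Finset.sum_const, Finset.card_range, nsmul_eq_mul, mul_one] at h
  rw [h]; ring

/-- Measure-and-reprogram, single input (Lemma 1):
`(1/(2q+1)) · Σ_{(i,b) ∈ R_q} ‖G_x (A^{H*Θx}_{i+b→q} (A^H_{i→i+b} (X_x (A^H_{0→i} φ₀))))‖²`
`  ≥ ‖G_x φ_q^{H*Θx}‖² / (2q+1)²`. -/
theorem measure_and_reprogram_single (q : ℕ) (hq : 1 ≤ q) (H : 𝒳 → 𝒴) (x : 𝒳) (Θ : 𝒴)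
    (φ₀ : EuclideanSpace ℂ (Bool × 𝒳 × 𝒴 × Z))
    (A : ℕ → (EuclideanSpace ℂ (Bool × 𝒳 × 𝒴 × Z) →ₗ[ℂ] EuclideanSpace ℂ (Bool × 𝒳 × 𝒴 × Z)))
    (hA : ∀ k, 1 ≤ k → k ≤ q →
      ∃ U P, IsUnitaryOp U ∧ IsOrthProjection P ∧ (A k = U ∘ₗ P ∨ A k = P ∘ₗ U))
    (π : EuclideanSpace ℂ Z →ₗ[ℂ] EuclideanSpace ℂ Z) (hπ : IsOrthProjection π) :
    (1 / (2 * (q : ℝ) + 1)) *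
        ∑ r ∈ Rq q,
          ‖(Xproj x ∘ₗ liftZ π)
              (AComp A (Function.update H x Θ) (r.1 + r.2) q
                (AComp A H r.1 (r.1 + r.2) (Xproj x (AComp A H 0 r.1 φ₀))))‖ ^ 2
      ≥ ‖(Xproj x ∘ₗ liftZ π) (AComp A (Function.update H x Θ) 0 q φ₀)‖ ^ 2
          / (2 * (q : ℝ) + 1) ^ 2 := by
  set K := Function.update H x Θ with hK
  set G := (Xproj x ∘ₗ liftZ π :
    EuclideanSpace ℂ (Bool × 𝒳 × 𝒴 × Z) →ₗ[ℂ] EuclideanSpace ℂ (Bool × 𝒳 × 𝒴 × Z)) with hG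
  set f : ℕ × ℕ → ℝ := fun r => ‖G (AComp A K (r.1 + r.2) q
    (AComp A H r.1 (r.1 + r.2) (Xproj x (AComp A H 0 r.1 φ₀))))‖ with hf
  -- telescoping
  have tele : ∀ n, n ≤ q → ‖G (AComp A K 0 q φ₀)‖ ≤
      ∑ i ∈ Finset.range n, (f (i, 0) + f (i, 1)) + ‖G (AComp A K n q (AComp A H 0 n φ₀))‖ := by
    intro n
    induction n with
    | zero => intro _; simp [mr_AComp_self]
    | succ n ih =>
      intro hn
      refine (ih (by omega)).trans ?_
      rw [Finset.sum_range_succ, add_assoc]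
      gcongr
      have e : AComp A K n q (AComp A H 0 n φ₀)
          = AComp A K (n + 1) q (AComp A H 0 (n + 1) φ₀)
            - AComp A K (n + 1) q (AComp A H n (n + 1) (Xproj x (AComp A H 0 n φ₀)))
            + AComp A K n q (Xproj x (AComp A H 0 n φ₀)) := by
        rw [mr_AComp_left A K n q hn, mr_AComp_left A K n q hn, mr_oracle,
          mr_AComp_succ A H 0 n (Nat.zero_le _), mr_AComp_succ A H n n le_rfl, mr_AComp_self]
        simp only [map_add, map_sub, LinearMap.id_apply, hK]
      have e0 : f (n, 0) = ‖G (AComp A K n q (Xproj x (AComp A H 0 n φ₀)))‖ := by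
        simp [hf, mr_AComp_self]
      have e1 : f (n, 1) = ‖G (AComp A K (n + 1) q
          (AComp A H n (n + 1) (Xproj x (AComp A H 0 n φ₀))))‖ := rfl
      rw [e, e0, e1, map_add, map_sub]
      refine (norm_add_le _ _).trans ?_
      have := norm_sub_le (G (AComp A K (n + 1) q (AComp A H 0 (n + 1) φ₀)))
        (G (AComp A K (n + 1) q (AComp A H n (n + 1) (Xproj x (AComp A H 0 n φ₀)))))
      linarith
  have key : ‖G (AComp A K 0 q φ₀)‖ ≤ ∑ r ∈ Rq q, f r := by
    rw [mr_sum_Rq]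
    have e : f (q, 0) = ‖G (AComp A K q q (AComp A H 0 q φ₀))‖ := by
      simp only [hf, add_zero, mr_AComp_self, LinearMap.id_apply]
      rw [hG, mr_G]
    rw [e]
    exact tele q le_rfl
  have cs : ‖G (AComp A K 0 q φ₀)‖ ^ 2 ≤ (2 * (q : ℝ) + 1) * ∑ r ∈ Rq q, f r ^ 2 := by
    rw [← mr_card_Rq]
    exact (pow_le_pow_left₀ (norm_nonneg _) key 2).trans sq_sum_le_card_mul_sum_sq
  have hp : (0 : ℝ) < 2 * (q : ℝ) + 1 := by positivity
  show ‖G (AComp A K 0 q φ₀)‖ ^ 2 / (2 * (q : ℝ) + 1) ^ 2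
    ≤ 1 / (2 * (q : ℝ) + 1) * ∑ r ∈ Rq q, f r ^ 2
  rw [div_le_iff₀ (by positivity)]
  refine cs.trans (le_of_eq ?_)
  field_simp
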